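/- arXiv:1708.07259 — 2 statements merged into one kernel-verified Lean document; each statement's English description precedes it below -/
import Mathlib

section
/- Let T = w* β₁*∘β₂*∘β₃* + E ∈ ℝ^{d₁×d₂×d₃} with w* > 0 and unit vectors β₁*, β₂*, β₃*. Let u ∈ ℝ^{d₁}, v ∈ ℝ^{d₂} be unit vectors with ‖u − β₁*‖₂ ≤ ε₀ and ‖v − β₂*‖₂ ≤ ε₀ for some 0 ≤ ε₀ < 1, and let F₁, F₂, F₃ be index sets with supp(u) ∪ supp(β₁*) ⊆ F₁, |F₁| ≤ s₁, supp(v) ∪ supp(β₂*) ⊆ F₂, |F₂| ≤ s₂, supp(β₃*) ⊆ F₃, |F₃| ≤ s₃. Then ‖T_F ×₁ u ×₂ v‖₂ ≥ w*(1 − ε₀²) − η(E; s₁,s₂,s₃). -/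
open scoped BigOperators
open Matrix

noncomputable def l2 {d : ℕ} (v : Fin d → ℝ) : ℝ := Real.sqrt (∑ i, v i ^ 2)

noncomputable def linf {d : ℕ} (v : Fin d → ℝ) : ℝ := ⨆ i, |v i|

noncomputable def tv {d : ℕ} (β : Fin d → ℝ) : ℝ :=
  ∑ j ∈ Finset.range (d - 1),
    if h : j + 1 < d then |β ⟨j + 1, h⟩ - β ⟨j, Nat.lt_of_succ_lt h⟩| else 0

noncomputable def contract3 {d₁ d₂ d₃ : ℕ} (T : Fin d₁ × Fin d₂ × Fin d₃ → ℝ)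
    (u : Fin d₁ → ℝ) (v : Fin d₂ → ℝ) : Fin d₃ → ℝ :=
  fun k => ∑ i, ∑ j, T (i, j, k) * u i * v j

def outer3 {d₁ d₂ d₃ : ℕ} (a : Fin d₁ → ℝ) (b : Fin d₂ → ℝ) (c : Fin d₃ → ℝ) :
    Fin d₁ × Fin d₂ × Fin d₃ → ℝ :=
  fun p => a p.1 * b p.2.1 * c p.2.2

noncomputable def eta {d₁ d₂ d₃ : ℕ} (E : Fin d₁ × Fin d₂ × Fin d₃ → ℝ)
    (s₁ s₂ s₃ : ℕ) : ℝ :=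
  sSup { x : ℝ | ∃ (u : Fin d₁ → ℝ) (v : Fin d₂ → ℝ) (w : Fin d₃ → ℝ),
    l2 u = 1 ∧ l2 v = 1 ∧ l2 w = 1 ∧
    (Function.support u).ncard ≤ s₁ ∧ (Function.support v).ncard ≤ s₂ ∧
    (Function.support w).ncard ≤ s₃ ∧
    x = |∑ i, ∑ j, ∑ k, E (i, j, k) * u i * v j * w k| }

noncomputable def restrict3 {d₁ d₂ d₃ : ℕ} (T : Fin d₁ × Fin d₂ × Fin d₃ → ℝ)
    (F₁ : Finset (Fin d₁)) (F₂ : Finset (Fin d₂)) (F₃ : Finset (Fin d₃)) :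
    Fin d₁ × Fin d₂ × Fin d₃ → ℝ :=
  fun p => if p.1 ∈ F₁ ∧ p.2.1 ∈ F₂ ∧ p.2.2 ∈ F₃ then T p else 0

noncomputable def restrictVec {d : ℕ} (v : Fin d → ℝ) (F : Finset (Fin d)) : Fin d → ℝ :=
  fun i => if i ∈ F then v i else 0

noncomputable def vnormalize {d : ℕ} (v : Fin d → ℝ) : Fin d → ℝ :=
  fun i => v i / l2 v

def Dmat (d : ℕ) : Matrix (Fin (d - 1)) (Fin d) ℝ :=
  fun j i => if (i : ℕ) = (j : ℕ) then -1 else if (i : ℕ) = (j : ℕ) + 1 then 1 else 0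

noncomputable def Dpinv (d : ℕ) : Matrix (Fin d) (Fin (d - 1)) ℝ :=
  (Dmat d)ᵀ * (Dmat d * (Dmat d)ᵀ)⁻¹

noncomputable def Mconst (d : ℕ) : ℝ :=
  ⨆ j : Fin (d - 1), l2 (fun i => Dpinv d i j)

def gfun (C₁ ε₀ ξ : ℝ) (R : ℕ) : ℝ :=
  C₁ * ε₀ ^ 2 + 2 * ε₀ * ξ * ((R : ℝ) - 1) + ξ ^ 2 * ((R : ℝ) - 1)
theorem aux_l2_sq {d : ℕ} (v : Fin d → ℝ) : l2 v ^ 2 = ∑ i, v i ^ 2 :=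
  Real.sq_sqrt (Finset.sum_nonneg fun i _ => sq_nonneg _)

theorem aux_abs_le {d : ℕ} (v : Fin d → ℝ) (h : l2 v = 1) (i : Fin d) : |v i| ≤ 1 := by
  have h1 := aux_l2_sq v
  rw [h] at h1
  have h2 : v i ^ 2 ≤ ∑ i, v i ^ 2 :=
    Finset.single_le_sum (f := fun i => v i ^ 2) (fun i _ => sq_nonneg _) (Finset.mem_univ i)
  rw [← sq_le_one_iff_abs_le_one]
  linarith

theorem aux_inner {d : ℕ} (u b : Fin d → ℝ) (hu : l2 u = 1) (hb : l2 b = 1) (e : ℝ)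
    (h : l2 (fun i => u i - b i) ≤ e) : 1 - e ^ 2 / 2 ≤ ∑ i, u i * b i := by
  have h0 : 0 ≤ l2 (fun i => u i - b i) := Real.sqrt_nonneg _
  have h1 := aux_l2_sq (fun i => u i - b i)
  have h2 := aux_l2_sq u
  have h3 := aux_l2_sq b
  have h4 : ∑ i, (u i - b i) ^ 2 = ∑ i, u i ^ 2 - 2 * ∑ i, u i * b i + ∑ i, b i ^ 2 := by
    rw [Finset.mul_sum, ← Finset.sum_sub_distrib, ← Finset.sum_add_distrib]
    exact Finset.sum_congr rfl fun i _ => by ring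
  rw [hu] at h2
  rw [hb] at h3
  have h5 := pow_le_pow_left₀ h0 h 2
  linarith

theorem aux_cs {d : ℕ} (x b : Fin d → ℝ) (hb : l2 b = 1) : ∑ i, x i * b i ≤ l2 x := by
  have h := Real.sum_mul_le_sqrt_mul_sqrt Finset.univ x b
  unfold l2 at *
  rw [hb, mul_one] at h
  exact h

theorem aux_eta {d₁ d₂ d₃ : ℕ} (E : Fin d₁ × Fin d₂ × Fin d₃ → ℝ) (s₁ s₂ s₃ : ℕ)
    (u : Fin d₁ → ℝ) (v : Fin d₂ → ℝ) (w : Fin d₃ → ℝ)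
    (hu : l2 u = 1) (hv : l2 v = 1) (hw : l2 w = 1)
    (h1 : (Function.support u).ncard ≤ s₁) (h2 : (Function.support v).ncard ≤ s₂)
    (h3 : (Function.support w).ncard ≤ s₃) :
    |∑ i, ∑ j, ∑ k, E (i, j, k) * u i * v j * w k| ≤ eta E s₁ s₂ s₃ := by
  apply le_csSup
  · refine ⟨∑ i, ∑ j, ∑ k, |E (i, j, k)|, ?_⟩
    rintro x ⟨u, v, w, hu, hv, hw, -, -, -, rfl⟩
    refine (Finset.abs_sum_le_sum_abs _ _).trans (Finset.sum_le_sum fun i _ => ?_)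
    refine (Finset.abs_sum_le_sum_abs _ _).trans (Finset.sum_le_sum fun j _ => ?_)
    refine (Finset.abs_sum_le_sum_abs _ _).trans (Finset.sum_le_sum fun k _ => ?_)
    rw [abs_mul, abs_mul, abs_mul]
    have a1 := aux_abs_le u hu i
    have a2 := aux_abs_le v hv j
    have a3 := aux_abs_le w hw k
    have b1 := mul_le_of_le_one_right (abs_nonneg (E (i, j, k))) a1
    have b2 := mul_le_of_le_one_right (mul_nonneg (abs_nonneg (E (i, j, k))) (abs_nonneg (u i))) a2
    have b3 := mul_le_of_le_one_right (mul_nonneg (mul_nonneg (abs_nonneg (E (i, j, k)))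
      (abs_nonneg (u i))) (abs_nonneg (v j))) a3
    linarith
  · exact ⟨u, v, w, hu, hv, hw, h1, h2, h3, rfl⟩

theorem aux_card {d : ℕ} (x : Fin d → ℝ) (F : Finset (Fin d)) (s : ℕ)
    (h : Function.support x ⊆ ↑F) (hs : F.card ≤ s) : (Function.support x).ncard ≤ s := by
  have := Set.ncard_le_ncard h F.finite_toSet
  rw [Set.ncard_coe_finset] at this
  omega

/-- Denominator lower bound in the proof of Theorem 1 of the paper. -/
theorem statement2 {d₁ d₂ d₃ : ℕ}
    (wstar : ℝ) (hw : 0 < wstar)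
    (β₁ : Fin d₁ → ℝ) (β₂ : Fin d₂ → ℝ) (β₃ : Fin d₃ → ℝ)
    (hβ₁ : l2 β₁ = 1) (hβ₂ : l2 β₂ = 1) (hβ₃ : l2 β₃ = 1)
    (E T : Fin d₁ × Fin d₂ × Fin d₃ → ℝ)
    (hT : T = fun p => wstar * outer3 β₁ β₂ β₃ p + E p)
    (u : Fin d₁ → ℝ) (v : Fin d₂ → ℝ) (hu : l2 u = 1) (hv : l2 v = 1)
    (ε₀ : ℝ) (hε₀0 : 0 ≤ ε₀) (hε₀1 : ε₀ < 1)
    (hu' : l2 (fun i => u i - β₁ i) ≤ ε₀) (hv' : l2 (fun i => v i - β₂ i) ≤ ε₀)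
    (s₁ s₂ s₃ : ℕ)
    (F₁ : Finset (Fin d₁)) (F₂ : Finset (Fin d₂)) (F₃ : Finset (Fin d₃))
    (hF₁ : Function.support u ∪ Function.support β₁ ⊆ ↑F₁) (hF₁c : F₁.card ≤ s₁)
    (hF₂ : Function.support v ∪ Function.support β₂ ⊆ ↑F₂) (hF₂c : F₂.card ≤ s₂)
    (hF₃ : Function.support β₃ ⊆ ↑F₃) (hF₃c : F₃.card ≤ s₃) :
    wstar * (1 - ε₀ ^ 2) - eta E s₁ s₂ s₃
      ≤ l2 (contract3 (restrict3 T F₁ F₂ F₃) u v) := by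
  have hu0 : ∀ i, i ∉ F₁ → u i = 0 := fun i hi => by
    by_contra h
    exact hi (hF₁ (Or.inl h))
  have hv0 : ∀ i, i ∉ F₂ → v i = 0 := fun i hi => by
    by_contra h
    exact hi (hF₂ (Or.inl h))
  have hb0 : ∀ i, i ∉ F₃ → β₃ i = 0 := fun i hi => by
    by_contra h
    exact hi (hF₃ h)
  have hcs := aux_cs (contract3 (restrict3 T F₁ F₂ F₃) u v) β₃ hβ₃
  have heta := aux_eta E s₁ s₂ s₃ u v β₃ hu hv hβ₃
    (aux_card u F₁ s₁ (Set.subset_union_left.trans hF₁) hF₁c)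
    (aux_card v F₂ s₂ (Set.subset_union_left.trans hF₂) hF₂c)
    (aux_card β₃ F₃ s₃ hF₃ hF₃c)
  have ha := aux_inner u β₁ hu hβ₁ ε₀ hu'
  have hb := aux_inner v β₂ hv hβ₂ ε₀ hv'
  have hc := aux_l2_sq β₃
  rw [hβ₃] at hc
  have key : ∑ k, contract3 (restrict3 T F₁ F₂ F₃) u v k * β₃ k
      = wstar * ((∑ i, u i * β₁ i) * ((∑ j, v j * β₂ j) * ∑ k, β₃ k ^ 2))
        + ∑ i, ∑ j, ∑ k, E (i, j, k) * u i * v j * β₃ k := by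
    have e1 : ∑ k, contract3 (restrict3 T F₁ F₂ F₃) u v k * β₃ k
        = ∑ i, ∑ j, ∑ k, restrict3 T F₁ F₂ F₃ (i, j, k) * u i * v j * β₃ k := by
      simp only [contract3, Finset.sum_mul]
      rw [Finset.sum_comm]
      exact Finset.sum_congr rfl fun i _ => Finset.sum_comm
    rw [e1, Finset.sum_mul_sum, Finset.sum_mul_sum]
    simp only [Finset.mul_sum]
    simp only [← Finset.sum_add_distrib]
    refine Finset.sum_congr rfl fun i _ => Finset.sum_congr rfl fun j _ =>
      Finset.sum_congr rfl fun k _ => ?_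
    by_cases h1 : i ∈ F₁
    · by_cases h2 : j ∈ F₂
      · by_cases h3 : k ∈ F₃
        · simp only [restrict3, h1, h2, h3, and_self, if_true, hT, outer3]
          ring
        · simp [hb0 k h3]
      · simp [hv0 j h2]
    · simp [hu0 i h1]
  rw [← hc] at key
  have hE := neg_abs_le (∑ i, ∑ j, ∑ k, E (i, j, k) * u i * v j * β₃ k)
  have hpos : 0 ≤ 1 - ε₀ ^ 2 / 2 := by nlinarith
  have hab := mul_le_mul ha hb hpos (hpos.trans ha)
  have hab' : 1 - ε₀ ^ 2 ≤ (∑ i, u i * β₁ i) * ∑ j, v j * β₂ j := by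
    nlinarith [sq_nonneg (ε₀ ^ 2)]
  have hfin := mul_le_mul_of_nonneg_left hab' hw.le
  norm_num at key
  linarith
end

section
/- There exists a constant C > 0 such that for all positive integers d₁, d₂, d₃ with d₁d₂d₃ ≥ 2 and all 1 ≤ s₁ ≤ d₁, 1 ≤ s₂ ≤ d₂, 1 ≤ s₃ ≤ d₃ the following holds: if G ∈ ℝ^{d₁×d₂×d₃} is a random tensor whose entries are independent standard Gaussian N(0,1) random variables, then with probability at least 1 − 2 exp( − s₁s₂s₃ log(d₁d₂d₃) / 2 ), one has η(G; s₁,s₂,s₃) ≤ C √( s₁ s₂ s₃ log(d₁ d₂ d₃) ). -/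
open scoped BigOperators
open Matrix

open MeasureTheory ProbabilityTheory

lemma aux_gauss : Integrable (fun x : ℝ => Real.exp (x ^ 2 / 4)) (gaussianReal 0 1) ∧
    ∫ x, Real.exp (x ^ 2 / 4) ∂(gaussianReal 0 1) ≤ 2 := by
  have key : ∀ x : ℝ, gaussianPDFReal 0 1 x * Real.exp (x ^ 2 / 4)
      = (√(2 * Real.pi))⁻¹ * Real.exp (-(1/4) * x ^ 2) := by
    intro x
    rw [gaussianPDFReal, mul_assoc, ← Real.exp_add]
    norm_num
    left
    ring
  have hint : Integrable (fun x : ℝ => (√(2 * Real.pi))⁻¹ * Real.exp (-(1/4) * x ^ 2)) :=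
    (integrable_exp_neg_mul_sq (by norm_num)).const_mul _
  constructor
  · rw [gaussianReal_of_var_ne_zero _ one_ne_zero,
      integrable_withDensity_iff_integrable_smul' (measurable_gaussianPDF 0 1)
        (ae_of_all _ fun x => gaussianPDF_lt_top)]
    simp only [toReal_gaussianPDF, smul_eq_mul, key]
    exact hint
  · rw [integral_gaussianReal_eq_integral_smul one_ne_zero]
    simp only [smul_eq_mul, key]
    rw [integral_const_mul, integral_gaussian]
    have hp := Real.pi_pos
    have h2 : 0 < √(2 * Real.pi) := by positivity
    rw [inv_mul_le_iff₀ h2]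
    have : (2:ℝ) = √4 := by
      rw [show (4:ℝ) = 2 ^ 2 by norm_num]; simp
    rw [Real.sqrt_le_left (by positivity)]
    rw [mul_pow, Real.sq_sqrt (by positivity)]
    linarith

noncomputable def auxF {ι : Type*} [Fintype ι] (D : ℝ) (G : ι → ℝ) : ℝ :=
  ∏ p, (1 + Real.exp (G p ^ 2 / 4) / D)

lemma aux_F {ι : Type*} [Fintype ι] (D : ℝ) (hD : 1 ≤ D) (hc : (Fintype.card ι : ℝ) = D) :
    Integrable (auxF D) (Measure.pi fun _ : ι => gaussianReal 0 1) ∧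
    ∫ G, auxF D G ∂(Measure.pi fun _ : ι => gaussianReal 0 1) ≤ Real.exp 2 := by
  obtain ⟨h1, h2⟩ := aux_gauss
  have hi : Integrable (fun x : ℝ => 1 + Real.exp (x ^ 2 / 4) / D) (gaussianReal 0 1) :=
    (integrable_const _).add (h1.div_const _)
  constructor
  · exact Integrable.fintype_prod (f := fun (_ : ι) (x : ℝ) => 1 + Real.exp (x ^ 2 / 4) / D)
      (fun _ => hi)
  · unfold auxF
    rw [integral_fintype_prod_eq_prod (fun (_ : ι) (x : ℝ) => 1 + Real.exp (x ^ 2 / 4) / D)]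
    rw [Finset.prod_const, Finset.card_univ]
    have hD0 : 0 < D := by linarith
    have : ∫ x, (1 + Real.exp (x ^ 2 / 4) / D) ∂(gaussianReal 0 1) ≤ Real.exp (2 / D) := by
      rw [integral_add (integrable_const _) (h1.div_const _), integral_div]
      simp only [integral_const, probReal_univ, smul_eq_mul, mul_one]
      have := Real.add_one_le_exp (2 / D)
      have : (∫ x, Real.exp (x ^ 2 / 4) ∂(gaussianReal 0 1)) / D ≤ 2 / D := by gcongr
      linarith
    calc _ ≤ Real.exp (2 / D) ^ (Fintype.card ι) := by
          apply pow_le_pow_left₀ _ this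
          apply integral_nonneg
          intro x
          positivity
      _ = Real.exp 2 := by
          rw [← Real.exp_nat_mul, hc]
          congr 1
          field_simp

lemma aux_det {ι : Type*} [Fintype ι] [DecidableEq ι] (D : ℝ) (hD : 1 ≤ D) (N : ℕ) (G : ι → ℝ)
    (A : Finset ι) (hA : A.card ≤ N) (hF : auxF D G ≤ Real.exp (3 * (N * Real.log D))) :
    ∑ p ∈ A, G p ^ 2 ≤ 16 * (N * Real.log D) := by
  have hD0 : 0 < D := by linarith
  have h1 : ∏ p ∈ A, (Real.exp (G p ^ 2 / 4) / D) ≤ auxF D G := by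
    calc _ ≤ ∏ p ∈ A, (1 + Real.exp (G p ^ 2 / 4) / D) := by
          apply Finset.prod_le_prod
          · intros; positivity
          · intros; linarith
      _ ≤ _ := by
          unfold auxF
          rw [← Finset.prod_mul_prod_compl A]
          apply le_mul_of_one_le_right
          · exact Finset.prod_nonneg fun p _ => by positivity
          · apply Finset.one_le_prod
            intro p _
            have : 0 ≤ Real.exp (G p ^ 2 / 4) / D := by positivity
            linarith
  rw [Finset.prod_div_distrib, ← Real.exp_sum, Finset.prod_const, div_le_iff₀ (by positivity),
    ← Finset.sum_div] at h1
  have h2 : Real.exp ((∑ p ∈ A, G p ^ 2) / 4) ≤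
      Real.exp (3 * (N * Real.log D)) * Real.exp (N * Real.log D) := by
    refine h1.trans ?_
    apply mul_le_mul hF _ (by positivity) (by positivity)
    rw [Real.exp_nat_mul, Real.exp_log hD0]
    exact pow_le_pow_right₀ hD hA
  rw [← Real.exp_add, Real.exp_le_exp] at h2
  linarith

lemma aux_eta_s11 {d₁ d₂ d₃ : ℕ} (G : Fin d₁ × Fin d₂ × Fin d₃ → ℝ) (s₁ s₂ s₃ : ℕ) (B : ℝ)
    (h : ∀ A : Finset (Fin d₁ × Fin d₂ × Fin d₃), A.card ≤ s₁ * s₂ * s₃ →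
      ∑ p ∈ A, G p ^ 2 ≤ B) : eta G s₁ s₂ s₃ ≤ √B := by
  classical
  unfold eta
  apply Real.sSup_le _ (Real.sqrt_nonneg _)
  rintro x ⟨u, v, w, hu, hv, hw, cu, cv, cw, rfl⟩
  have fin : ∀ {d s : ℕ} (u : Fin d → ℝ), (Function.support u).ncard ≤ s →
      (Finset.univ.filter fun i => u i ≠ 0).card ≤ s := by
    intro d s u h
    rw [← Set.ncard_coe_finset]
    simpa [Function.support] using h
  have sq : ∀ {d : ℕ} (u : Fin d → ℝ), l2 u = 1 → ∑ i, u i ^ 2 = 1 := by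
    intro d u h
    unfold l2 at h
    rwa [Real.sqrt_eq_one] at h
  set A : Finset (Fin d₁ × Fin d₂ × Fin d₃) :=
    (Finset.univ.filter fun i => u i ≠ 0) ×ˢ (Finset.univ.filter fun i => v i ≠ 0) ×ˢ
      (Finset.univ.filter fun i => w i ≠ 0) with hAdef
  have hA : A.card ≤ s₁ * s₂ * s₃ := by
    rw [hAdef, Finset.card_product, Finset.card_product, mul_assoc]
    exact Nat.mul_le_mul (fin u cu) (Nat.mul_le_mul (fin v cv) (fin w cw))
  have e1 : ∑ i, ∑ j, ∑ k, G (i, j, k) * u i * v j * w k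
      = ∑ p ∈ A, G p * (u p.1 * v p.2.1 * w p.2.2) := by
    have : ∑ i, ∑ j, ∑ k, G (i, j, k) * u i * v j * w k
      = ∑ p : Fin d₁ × Fin d₂ × Fin d₃, G p * (u p.1 * v p.2.1 * w p.2.2) := by
      simp only [Fintype.sum_prod_type]
      refine Finset.sum_congr rfl fun i _ => Finset.sum_congr rfl fun j _ =>
        Finset.sum_congr rfl fun k _ => ?_
      ring
    rw [this]
    symm
    apply Finset.sum_subset (Finset.subset_univ _)
    rintro ⟨i, j, k⟩ _ hp
    simp only [hAdef, Finset.mem_product, Finset.mem_filter, Finset.mem_univ, true_and] at hp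
    have : u i = 0 ∨ v j = 0 ∨ w k = 0 := by tauto
    rcases this with h | h | h <;> simp [h]
  have e2 : ∑ p ∈ A, (u p.1 * v p.2.1 * w p.2.2) ^ 2 ≤ 1 := by
    calc _ ≤ ∑ p : Fin d₁ × Fin d₂ × Fin d₃, (u p.1 * v p.2.1 * w p.2.2) ^ 2 :=
          Finset.sum_le_sum_of_subset_of_nonneg (Finset.subset_univ _)
            (fun _ _ _ => by positivity)
      _ = (∑ i, u i ^ 2) * ((∑ i, v i ^ 2) * (∑ i, w i ^ 2)) := by
          rw [Finset.sum_mul_sum, Finset.sum_mul_sum]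
          simp only [Fintype.sum_prod_type, mul_pow, Finset.mul_sum, mul_assoc]
      _ = 1 := by rw [sq u hu, sq v hv, sq w hw]; norm_num
      _ ≤ 1 := le_rfl
  rw [e1]
  apply Real.abs_le_sqrt
  calc _ ≤ (∑ p ∈ A, G p ^ 2) * ∑ p ∈ A, (u p.1 * v p.2.1 * w p.2.2) ^ 2 :=
        Finset.sum_mul_sq_le_sq_mul_sq _ _ _
    _ ≤ (∑ p ∈ A, G p ^ 2) * 1 := by
        apply mul_le_mul_of_nonneg_left e2
        exact Finset.sum_nonneg fun _ _ => sq_nonneg _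
    _ ≤ B := by rw [mul_one]; exact h A hA


/-- High-probability sparse spectral norm bound for a standard Gaussian tensor
(proof of Corollary 2). -/
theorem statement11 :
    ∃ C : ℝ, 0 < C ∧
      ∀ d₁ d₂ d₃ s₁ s₂ s₃ : ℕ, 0 < d₁ → 0 < d₂ → 0 < d₃ → 2 ≤ d₁ * d₂ * d₃ →
        1 ≤ s₁ → s₁ ≤ d₁ → 1 ≤ s₂ → s₂ ≤ d₂ → 1 ≤ s₃ → s₃ ≤ d₃ →
        ENNReal.ofReal
            (1 - 2 * Real.exp
              (-((s₁ : ℝ) * s₂ * s₃ * Real.log ((d₁ : ℝ) * d₂ * d₃)) / 2))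
          ≤ (Measure.pi fun _ : Fin d₁ × Fin d₂ × Fin d₃ => gaussianReal 0 1)
              { G : Fin d₁ × Fin d₂ × Fin d₃ → ℝ |
                eta G s₁ s₂ s₃
                  ≤ C * Real.sqrt ((s₁ : ℝ) * s₂ * s₃ * Real.log ((d₁ : ℝ) * d₂ * d₃)) } := by
  refine ⟨4, by norm_num, ?_⟩
  intro d₁ d₂ d₃ s₁ s₂ s₃ _ _ _ hd h1 _ h2 _ h3 _
  set D : ℝ := (d₁ : ℝ) * d₂ * d₃ with hDdef
  have hD2 : 2 ≤ D := by rw [hDdef]; exact_mod_cast hd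
  set L : ℝ := (s₁ : ℝ) * s₂ * s₃ * Real.log D with hL
  have hN : 1 ≤ s₁ * s₂ * s₃ := Nat.mul_pos (Nat.mul_pos h1 h2) h3
  have hNL : ((s₁ * s₂ * s₃ : ℕ) : ℝ) * Real.log D = L := by rw [hL]; push_cast; ring
  have hLlog : Real.log 2 ≤ L := by
    rw [← hNL]
    have a1 : (1 : ℝ) ≤ ((s₁ * s₂ * s₃ : ℕ) : ℝ) := by exact_mod_cast hN
    have a2 : Real.log 2 ≤ Real.log D := Real.log_le_log (by norm_num) hD2
    have a3 : 0 ≤ Real.log 2 := Real.log_nonneg (by norm_num)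
    nlinarith
  set P := (Measure.pi fun _ : Fin d₁ × Fin d₂ × Fin d₃ => gaussianReal 0 1) with hP
  obtain ⟨f1, f2⟩ := aux_F (ι := Fin d₁ × Fin d₂ × Fin d₃) D (by linarith)
    (by rw [hDdef]; simp [mul_assoc])
  have hmark := mul_meas_ge_le_integral_of_nonneg (μ := P) (f := auxF D)
    (ae_of_all _ fun G => by
      have : 0 < D := by linarith
      unfold auxF
      exact Finset.prod_nonneg fun p _ => by positivity) f1 (Real.exp (3 * L))
  have hmeas : MeasurableSet {G : Fin d₁ × Fin d₂ × Fin d₃ → ℝ | Real.exp (3 * L) ≤ auxF D G} := by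
    apply measurableSet_le measurable_const
    unfold auxF
    fun_prop
  have hb : P.real {G | Real.exp (3 * L) ≤ auxF D G} ≤ 2 * Real.exp (-L / 2) := by
    have h0 : 0 < Real.exp (3 * L) := Real.exp_pos _
    have : Real.exp 2 ≤ Real.exp (3 * L) * (2 * Real.exp (-L / 2)) := by
      rw [mul_left_comm, ← Real.exp_add]
      nth_rw 2 [← Real.exp_log (show (0:ℝ) < 2 by norm_num)]
      rw [← Real.exp_add, Real.exp_le_exp]
      have := Real.log_two_gt_d9
      linarith
    have h4 := (hmark.trans f2).trans this
    exact le_of_mul_le_mul_left h4 h0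
  have hsub : {G : Fin d₁ × Fin d₂ × Fin d₃ → ℝ | Real.exp (3 * L) ≤ auxF D G}ᶜ ⊆
      {G | eta G s₁ s₂ s₃ ≤ 4 * √L} := by
    intro G hG
    simp only [Set.mem_compl_iff, Set.mem_ofPred_eq, not_le] at hG ⊢
    have : 4 * √L = √(16 * L) := by
      rw [show (16:ℝ) = 4 ^ 2 by norm_num, Real.sqrt_mul (x := 4 ^ 2) (by norm_num) L,
        Real.sqrt_sq (by norm_num)]
    rw [this]
    apply aux_eta_s11
    intro A hA
    rw [← hNL] at hG ⊢
    exact aux_det D (by linarith) _ G A hA hG.le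
  refine le_trans ?_ (measure_mono hsub)
  rw [← ofReal_measureReal, probReal_compl_eq_one_sub hmeas]
  apply ENNReal.ofReal_le_ofReal
  linarith
end
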